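/- arXiv:quant-ph/0501056 — 2 statements merged into one kernel-verified Lean document; each statement's English description precedes it below -/
import Mathlib

section
/- Let G be a finite group and ρ : G → U(V) an irreducible unitary representation of dimension d_ρ. Let [m] be a conjugacy class of G consisting of involutions, and for m ∈ [m] let Π_m = (1/2)(id_V + ρ(m)). Then for every b ∈ V, the variance of ‖Π_m b‖² over m chosen uniformly from [m] is at most (1/4) Σ_σ (χ_σ([m])/d_σ)·‖Π_σ(|b⟩⟨b|)‖², where the sum runs over the irreducible characters σ of G and Π_σ is the orthogonal projection of End(V) (with Frobenius inner product) onto the σ-isotypic component of the conjugation representation g·A = ρ(g) A ρ(g)⁻¹. -/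
open scoped InnerProductSpace

/-- The rank-one operator `|b⟩⟨b| : v ↦ ⟨b,v⟩·b`. -/
noncomputable def outerSelf {V : Type*} [NormedAddCommGroup V] [InnerProductSpace ℂ V]
    (b : V) : V →ₗ[ℂ] V :=
  (innerₛₗ ℂ b).smulRight b

/-- The Frobenius inner product `⟨A,B⟩ = tr(A†B)` on `End(V)`. -/
noncomputable def frobInner {V : Type*} [NormedAddCommGroup V] [InnerProductSpace ℂ V]
    [FiniteDimensional ℂ V] (A B : V →ₗ[ℂ] V) : ℂ :=
  LinearMap.trace ℂ V (LinearMap.adjoint A ∘ₗ B)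

/-- The conjugation action of `g ∈ G` on `End(V)`: `A ↦ ρ(g) A ρ(g)⁻¹`. -/
noncomputable def conjEnd {G V : Type*} [Group G] [NormedAddCommGroup V]
    [InnerProductSpace ℂ V] (ρ : G →* (V ≃ₗᵢ[ℂ] V)) (g : G) (A : V →ₗ[ℂ] V) :
    V →ₗ[ℂ] V :=
  ((ρ g).toLinearEquiv : V →ₗ[ℂ] V) ∘ₗ A ∘ₗ ((ρ g⁻¹).toLinearEquiv : V →ₗ[ℂ] V)

/-- `f : G → ℂ` is an irreducible character of `G`. -/
def IsIrreducibleCharacter (G : Type) [Group G] (f : G → ℂ) : Prop :=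
  ∃ W : FDRep ℂ G, CategoryTheory.Simple W ∧ ∀ g : G, W.character g = f g

/-- The `σ`-isotypic orthogonal projection of the conjugation representation on `End(V)`,
applied to `A`; here `f = χ_σ` and `d_σ = f 1`. -/
noncomputable def isotypicProjEnd {G V : Type*} [Group G] [Fintype G] [NormedAddCommGroup V]
    [InnerProductSpace ℂ V] (ρ : G →* (V ≃ₗᵢ[ℂ] V)) (f : G → ℂ) (A : V →ₗ[ℂ] V) :
    V →ₗ[ℂ] V :=
  (f 1 / (Nat.card G : ℂ)) • ∑ g : G, (starRingEnd ℂ (f g)) • conjEnd ρ g A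

namespace Representation

open scoped ComplexOrder in
/-- The character of a complex representation of a finite group satisfies `χ(g⁻¹) = conj χ(g)`. -/
theorem character_inv_eq_conj {G W : Type*} [Group G] [Fintype G] [AddCommGroup W] [Module ℂ W]
    [FiniteDimensional ℂ W] (π : Representation ℂ G W) (h : G) :
    π.character h⁻¹ = starRingEnd ℂ (π.character h) := by
  classical
  let e := LinearMap.toMatrixAlgEquiv (Module.finBasis ℂ W)
  let A : G → Matrix _ _ ℂ := fun g => e (π g)
  have hA : ∀ g k, A (g * k) = A g * A k := fun g k => by simp [A]
  have hA1 : A 1 = 1 := by simp [A]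
  have htr : ∀ g, π.character g = (A g).trace := fun g => by
    simp only [character, A, e]
    rw [LinearMap.trace_eq_matrix_trace ℂ (Module.finBasis ℂ W)]
    rfl
  let P := ∑ g, (A g).conjTranspose * A g
  have hP : P.PosDef := by
    have h1 : P = 1 + ∑ g ∈ Finset.univ.erase 1, (A g).conjTranspose * A g := by
      simp only [P]
      rw [← Finset.add_sum_erase _ _ (Finset.mem_univ 1), hA1]
      simp
    rw [h1]
    exact Matrix.PosDef.one.add_posSemidef
      (Matrix.posSemidef_sum _ fun g _ => Matrix.posSemidef_conjTranspose_mul_self _)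
  have hinv : (A h).conjTranspose * P * A h = P := by
    simp only [P, Finset.mul_sum, Finset.sum_mul]
    refine Fintype.sum_equiv (Equiv.mulRight h) _ _ fun g => ?_
    simp [hA, Matrix.mul_assoc]
  have hu : IsUnit P.det := (Matrix.isUnit_iff_isUnit_det P).1 hP.isUnit
  have h2 : P * A h⁻¹ = (A h).conjTranspose * P := by
    calc P * A h⁻¹ = (A h).conjTranspose * P * A h * A h⁻¹ := by rw [hinv]
      _ = _ := by rw [Matrix.mul_assoc _ (A h), ← hA, mul_inv_cancel, hA1, Matrix.mul_one]
  have h3 : A h⁻¹ = P⁻¹ * ((A h).conjTranspose * P) := by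
    rw [← h2, ← Matrix.mul_assoc, Matrix.nonsing_inv_mul _ hu, Matrix.one_mul]
  rw [htr, htr, h3, Matrix.trace_mul_comm, Matrix.mul_assoc, Matrix.mul_nonsing_inv _ hu,
    Matrix.mul_one, Matrix.trace_conjTranspose]
  rfl

section Schur

variable {G W : Type*} [Group G] [Fintype G] [AddCommGroup W] [Module ℂ W]
  [FiniteDimensional ℂ W] (π : Representation ℂ G W)

/-- A representation whose character has norm one is nonzero. -/
theorem finrank_ne_zero_of_sum_char_mul_char_inv
    (hπ : ∑ g, π.character g * π.character g⁻¹ = Nat.card G) :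
    (Module.finrank ℂ W : ℂ) ≠ 0 := by
  intro h0
  have h0' : Module.finrank ℂ W = 0 := by exact_mod_cast h0
  have : Subsingleton W := Module.finrank_zero_iff.1 h0'
  have hz : ∀ g, π.character g = 0 := fun g => by
    rw [character, Subsingleton.elim (π g) 0, map_zero]
  simp only [hz, mul_zero, Finset.sum_const_zero] at hπ
  exact Nat.card_pos.ne' (by exact_mod_cast hπ.symm : Nat.card G = 0)

/-- On a representation whose character has norm one, `∑ φ(g) π(g)` is a scalar for every class
function `φ`. -/
theorem sum_classFunction_smul_eq_smul_one
    (hπ : ∑ g, π.character g * π.character g⁻¹ = Nat.card G)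
    (φ : G → ℂ) (hφ : ∀ g h, φ (h * g * h⁻¹) = φ g) :
    ∑ g, φ g • π g =
      ((∑ g, φ g * π.character g) / (Module.finrank ℂ W : ℂ)) • (1 : W →ₗ[ℂ] W) := by
  have hcard : (Nat.card G : ℂ) ≠ 0 := by exact_mod_cast Nat.card_pos.ne'
  let := invertibleOfNonzero hcard
  have hd := finrank_ne_zero_of_sum_char_mul_char_inv π hπ
  have hr : Module.finrank ℂ (IntertwiningMap π π) = 1 := by
    have := card_inv_mul_sum_char_mul_char_eq_finrank π π
    rw [hπ, inv_mul_cancel₀ hcard] at this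
    exact_mod_cast this.symm
  let T : IntertwiningMap π π := ⟨∑ g, φ g • π g, fun h => by
    rw [← Module.End.mul_eq_comp, ← Module.End.mul_eq_comp, Finset.sum_mul, Finset.mul_sum]
    refine Fintype.sum_equiv (MulAut.conj h⁻¹).toEquiv _ _ fun g => ?_
    have := hφ g h⁻¹
    simp only [inv_inv] at this
    simp only [MulEquiv.toEquiv_eq_coe, EquivLike.coe_coe, MulAut.conj_apply, inv_inv, this,
      smul_mul_assoc, mul_smul_comm, ← map_mul]
    congr 1
    congr 1
    group⟩
  have hone : IntertwiningMap.id π ≠ 0 := by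
    intro h
    have h1 := congrArg IntertwiningMap.toLinearMap h
    have h2 := congrArg (LinearMap.trace ℂ W) h1
    apply hd
    simpa using h2
  obtain ⟨c, hc⟩ := (finrank_eq_one_iff_of_nonzero' _ hone).1 hr T
  have hc' : ∑ g, φ g • π g = c • (1 : W →ₗ[ℂ] W) :=
    (congrArg IntertwiningMap.toLinearMap hc).symm
  have ht := congrArg (LinearMap.trace ℂ W) hc'
  simp only [map_sum, map_smul, LinearMap.trace_one, smul_eq_mul] at ht
  rw [hc', show (∑ g, φ g * π.character g) = c * Module.finrank ℂ W from ht,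
    mul_div_cancel_right₀ _ hd]

/-- The convolution identity for a character of norm one. -/
theorem sum_char_inv_mul_char_mul
    (hπ : ∑ g, π.character g * π.character g⁻¹ = Nat.card G) (x : G) :
    ∑ g, π.character g⁻¹ * π.character (g * x) =
      (Nat.card G : ℂ) / π.character 1 * π.character x := by
  have h := sum_classFunction_smul_eq_smul_one π hπ (fun g => π.character g⁻¹) fun g h => by
    rw [← char_conj π g⁻¹ h]
    congr 1
    group
  have h2 := congrArg (fun T => LinearMap.trace ℂ W (T * π x)) h
  simp only [Finset.sum_mul, smul_mul_assoc, map_sum, map_smul, smul_eq_mul, one_mul,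
    ← map_mul] at h2
  rw [show ∑ g, π.character g⁻¹ * π.character g = Nat.card G by
    rw [← hπ]; exact Finset.sum_congr rfl fun g _ => mul_comm _ _] at h2
  rw [char_one]
  exact h2

end Schur

end Representation

namespace FDRep

open CategoryTheory

theorem simple_of_isIrreducible {G W : Type} [Group G] [Fintype G] [AddCommGroup W] [Module ℂ W]
    [FiniteDimensional ℂ W] (π : Representation ℂ G W) [π.IsIrreducible] :
    Simple (FDRep.of π) := by
  rw [simple_iff_char_is_norm_one]
  have hcard : (Nat.card G : ℂ) ≠ 0 := by exact_mod_cast Nat.card_pos.ne'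
  let := invertibleOfNonzero hcard
  have := Representation.char_orthonormal π π
  rw [if_pos ⟨Representation.Equiv.refl π⟩, inv_mul_eq_one₀ hcard] at this
  exact this.symm

end FDRep

/-- A class function orthogonal to all irreducible characters acts by zero on every
representation. -/
theorem Representation.sum_classFunction_smul_eq_zero {G : Type} [Group G] [Fintype G]
    (φ : G → ℂ) (hφ : ∀ g h, φ (h * g * h⁻¹) = φ g)
    (h0 : ∀ f, IsIrreducibleCharacter G f → ∑ g, φ g * f g = 0)
    {W : Type} [AddCommGroup W] [Module ℂ W] [FiniteDimensional ℂ W]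
    (π : Representation ℂ G W) : ∑ g, φ g • π g = 0 := by
  induction hn : Module.finrank ℂ W using Nat.strong_induction_on generalizing W with
  | _ n ih =>
  subst hn
  by_cases hirr : π.IsIrreducible
  · have hs := FDRep.simple_of_isIrreducible π
    rw [sum_classFunction_smul_eq_smul_one π ((FDRep.simple_iff_char_is_norm_one _).1 hs) φ hφ,
      h0 π.character ⟨FDRep.of π, hs, fun _ => rfl⟩]
    simp
  · by_cases hnt : Nontrivial (Subrepresentation π)
    · have hex : ∃ U : Subrepresentation π, U ≠ ⊥ ∧ U ≠ ⊤ := by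
        by_contra! hcon
        exact hirr ⟨fun U => or_iff_not_imp_left.2 (hcon U)⟩
      obtain ⟨U, hU0, hU1⟩ := hex
      have : NeZero (Nat.card G : ℂ) := ⟨by exact_mod_cast Nat.card_pos.ne'⟩
      obtain ⟨U', hUU'⟩ := exists_isCompl U
      have key : ∀ S : Subrepresentation π, S ≠ ⊤ → ∀ v ∈ S.toSubmodule,
          (∑ g, φ g • π g) v = 0 := by
        intro S hS v hv
        have hlt : Module.finrank ℂ S.toSubmodule < Module.finrank ℂ W :=
          Submodule.finrank_lt fun h => hS (Subrepresentation.toSubmodule_injective h)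
        have h1 := LinearMap.congr_fun (ih _ hlt S.toRepresentation rfl) ⟨v, hv⟩
        have h2 := congrArg Subtype.val h1
        simpa [LinearMap.sum_apply, Subrepresentation.toRepresentation] using h2
      have hU'1 : U' ≠ ⊤ := fun h => hU0 (by simpa [h] using hUU'.inf_eq_bot)
      ext v
      have hv : v ∈ U.toSubmodule ⊔ U'.toSubmodule := by
        have : (U ⊔ U').toSubmodule = ⊤ := by rw [hUU'.sup_eq_top]; rfl
        rw [← Subrepresentation.toSubmodule_sup, this]; trivial
      obtain ⟨u, hu, u', hu', rfl⟩ := Submodule.mem_sup.1 hv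
      rw [map_add, key U hU1 u hu, key U' hU'1 u' hu']
      simp
    · have : Subsingleton W := by
        rw [not_nontrivial_iff_subsingleton] at hnt
        have h := congrArg Subrepresentation.toSubmodule
          (Subsingleton.elim (⊥ : Subrepresentation π) ⊤)
        exact (Submodule.subsingleton_iff ℂ).1 ⟨fun a b => by
          have hb : (⊥ : Submodule ℂ W) = ⊤ := h
          rw [eq_bot_iff.2 (hb ▸ le_top : a ≤ ⊥), eq_bot_iff.2 (hb ▸ le_top : b ≤ ⊥)]⟩
      exact Subsingleton.elim _ _

/-- A class function orthogonal to all irreducible characters vanishes. -/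
theorem classFunction_eq_zero {G : Type} [Group G] [Fintype G]
    (φ : G → ℂ) (hφ : ∀ g h, φ (h * g * h⁻¹) = φ g)
    (h0 : ∀ f, IsIrreducibleCharacter G f → ∑ g, φ g * f g = 0) (x : G) : φ x = 0 := by
  classical
  have h := Representation.sum_classFunction_smul_eq_zero φ hφ h0 (Representation.leftRegular ℂ G)
  have h1 := LinearMap.congr_fun h (MonoidAlgebra.single 1 1)
  have h2 := DFunLike.congr_fun (congrArg MonoidAlgebra.coeff h1) x
  simpa [LinearMap.sum_apply, Finsupp.finsetSum_apply, Finsupp.single_apply] using h2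

namespace IsIrreducibleCharacter

variable {G : Type} [Group G] {f : G → ℂ}

theorem map_conj (hf : IsIrreducibleCharacter G f) (g h : G) : f (h * g * h⁻¹) = f g := by
  obtain ⟨W, -, hW⟩ := hf
  rw [← hW, ← hW, FDRep.char_conj]

theorem map_mul_comm (hf : IsIrreducibleCharacter G f) (g h : G) : f (g * h) = f (h * g) := by
  obtain ⟨W, -, hW⟩ := hf
  rw [← hW, ← hW, FDRep.char_mul_comm]

variable [Fintype G]

theorem map_inv (hf : IsIrreducibleCharacter G f) (g : G) : f g⁻¹ = starRingEnd ℂ (f g) := by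
  obtain ⟨W, -, hW⟩ := hf
  rw [← hW, ← hW]
  exact Representation.character_inv_eq_conj W.ρ g

theorem map_one_ne_zero (hf : IsIrreducibleCharacter G f) : f 1 ≠ 0 := by
  obtain ⟨W, hs, hW⟩ := hf
  rw [← hW, FDRep.char_one]
  exact Representation.finrank_ne_zero_of_sum_char_mul_char_inv W.ρ
    ((FDRep.simple_iff_char_is_norm_one W).1 hs)

theorem sum_inv_mul_mul (hf : IsIrreducibleCharacter G f) (x : G) :
    ∑ g, f g⁻¹ * f (g * x) = (Nat.card G : ℂ) / f 1 * f x := by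
  obtain ⟨W, hs, hW⟩ := hf
  simp only [← hW]
  exact Representation.sum_char_inv_mul_char_mul W.ρ
    ((FDRep.simple_iff_char_is_norm_one W).1 hs) x

theorem sum_inv_mul_self (hf : IsIrreducibleCharacter G f) :
    ∑ g, f g⁻¹ * f g = Nat.card G := by
  have h := hf.sum_inv_mul_mul 1
  simp only [mul_one] at h
  rw [h, div_mul_cancel₀ _ hf.map_one_ne_zero]

theorem sum_inv_mul_of_ne {f' : G → ℂ} (hf : IsIrreducibleCharacter G f)
    (hf' : IsIrreducibleCharacter G f') (hne : f ≠ f') : ∑ g, f g⁻¹ * f' g = 0 := by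
  obtain ⟨W, hs, hW⟩ := hf
  obtain ⟨W', hs', hW'⟩ := hf'
  have hcard : (Nat.card G : ℂ) ≠ 0 := by exact_mod_cast Nat.card_pos.ne'
  let := invertibleOfNonzero hcard
  have h := FDRep.char_orthonormal W' W
  rw [if_neg, mul_eq_zero] at h
  · rw [← h.resolve_left (inv_ne_zero hcard)]
    exact Finset.sum_congr rfl fun g _ => by rw [hW, hW', mul_comm]
  · rintro ⟨i⟩
    exact hne (funext fun g => by rw [← hW, ← hW', FDRep.char_iso i])

end IsIrreducibleCharacter

/-- Column orthogonality for the character table of a finite group. -/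
theorem sum_irreducibleCharacter_mul_inv {G : Type} [Group G] [Fintype G] [DecidableEq G]
    (Irr : Finset (G → ℂ)) (hIrr : ∀ f, f ∈ Irr ↔ IsIrreducibleCharacter G f) (m₀ : G)
    (M : Finset G) (hM : ∀ m, m ∈ M ↔ IsConj m₀ m) (x : G) :
    ∑ f ∈ Irr, f m₀ * f x⁻¹ = if x ∈ M then (Nat.card G : ℂ) / M.card else 0 := by
  classical
  have hMc : (M.card : ℂ) ≠ 0 := by
    exact_mod_cast (Finset.card_pos.2 ⟨m₀, (hM _).2 (IsConj.refl _)⟩).ne'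
  rw [← sub_eq_zero]
  refine classFunction_eq_zero
    (fun x => ∑ f ∈ Irr, f m₀ * f x⁻¹ - if x ∈ M then (Nat.card G : ℂ) / M.card else 0) ?_ ?_ x
  · intro g h
    have h1 : h * g * h⁻¹ ∈ M ↔ g ∈ M := by
      have hc : IsConj g (h * g * h⁻¹) := isConj_iff.2 ⟨h, rfl⟩
      rw [hM, hM]
      exact ⟨fun k => k.trans hc.symm, fun k => k.trans hc⟩
    simp only [h1]
    congr 1
    refine Finset.sum_congr rfl fun f hf => ?_
    rw [← ((hIrr f).1 hf).map_conj g⁻¹ h]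
    congr 2
    group
  · intro f' hf'
    simp only [sub_mul, Finset.sum_sub_distrib, Finset.sum_mul]
    rw [Finset.sum_comm]
    have h1 : ∀ f ∈ Irr, ∑ g, f m₀ * f g⁻¹ * f' g =
        if f = f' then f' m₀ * (Nat.card G : ℂ) else 0 := by
      intro f hf
      simp only [mul_assoc, ← Finset.mul_sum]
      split_ifs with h
      · rw [h, hf'.sum_inv_mul_self]
      · rw [((hIrr f).1 hf).sum_inv_mul_of_ne hf' h, mul_zero]
    rw [Finset.sum_congr rfl h1, Finset.sum_ite_eq', if_pos ((hIrr f').2 hf')]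
    have h2 : ∀ m ∈ M, (Nat.card G : ℂ) / M.card * f' m = (Nat.card G : ℂ) / M.card * f' m₀ := by
      intro m hm
      obtain ⟨c, rfl⟩ := isConj_iff.1 ((hM m).1 hm)
      rw [hf'.map_conj]
    simp only [ite_mul, zero_mul, Finset.sum_ite_mem, Finset.univ_inter]
    rw [Finset.sum_congr rfl h2, Finset.sum_const, nsmul_eq_mul]
    field_simp
    ring

section Frobenius

variable {V : Type*} [NormedAddCommGroup V] [InnerProductSpace ℂ V]

theorem conjEnd_outerSelf {G : Type*} [Group G] (ρ : G →* (V ≃ₗᵢ[ℂ] V)) (g : G) (b : V) :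
    conjEnd ρ g (outerSelf b) = outerSelf (ρ g b) := by
  ext v
  have h : ⟪b, ρ g⁻¹ v⟫_ℂ = ⟪ρ g b, v⟫_ℂ := by
    rw [← LinearIsometryEquiv.inner_map_map (ρ g) b]
    simp
  change ρ g (⟪b, ρ g⁻¹ v⟫_ℂ • b) = ⟪ρ g b, v⟫_ℂ • ρ g b
  rw [h, map_smul]

variable [FiniteDimensional ℂ V]

theorem frobInner_outerSelf (a c : V) :
    frobInner (outerSelf a) (outerSelf c) = (‖⟪a, c⟫_ℂ‖ : ℂ) ^ 2 := by
  have h : LinearMap.adjoint (outerSelf a) = outerSelf a := by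
    symm
    rw [LinearMap.eq_adjoint_iff]
    intro x y
    simp [outerSelf, inner_smul_left, inner_smul_right, mul_comm]
  have h2 : outerSelf a ∘ₗ outerSelf c = (innerₛₗ ℂ c).smulRight (⟪a, c⟫_ℂ • a) := by
    ext v
    simp [outerSelf, smul_smul, inner_smul_right]
  rw [frobInner, h, h2, LinearMap.trace_smulRight]
  simp only [innerₛₗ_apply_apply, inner_smul_right]
  rw [← inner_conj_symm c a, Complex.mul_conj]
  simp [Complex.normSq_eq_norm_sq]

theorem frobInner_smul_sum_smul {ι : Type*} [Fintype ι] (c : ℂ) (α : ι → ℂ)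
    (A : ι → V →ₗ[ℂ] V) :
    frobInner (c • ∑ i, α i • A i) (c • ∑ i, α i • A i) =
      (starRingEnd ℂ c * c) *
        ∑ i, ∑ j, starRingEnd ℂ (α i) * α j * frobInner (A i) (A j) := by
  simp only [frobInner, map_smulₛₗ, map_sum, ← Module.End.mul_eq_comp, smul_mul_assoc,
    mul_smul_comm, Finset.sum_mul, smul_eq_mul, Finset.mul_sum, RingHom.id_apply]
  rw [Finset.sum_comm]
  exact Finset.sum_congr rfl fun i _ => Finset.sum_congr rfl fun j _ => by ring

/-- `‖Π_σ(|b⟩⟨b|)‖² = (d_σ / |G|) ∑ₓ conj χ_σ(x) |⟨b, ρ(x) b⟩|²`. -/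
theorem frobInner_isotypicProjEnd_outerSelf {G : Type} [Group G] [Fintype G]
    (ρ : G →* (V ≃ₗᵢ[ℂ] V)) {f : G → ℂ} (hf : IsIrreducibleCharacter G f) (b : V) :
    frobInner (isotypicProjEnd ρ f (outerSelf b)) (isotypicProjEnd ρ f (outerSelf b)) =
      f 1 / Nat.card G * ∑ x, f x⁻¹ * (‖⟪b, ρ x b⟫_ℂ‖ : ℂ) ^ 2 := by
  have hcard : (Nat.card G : ℂ) ≠ 0 := by exact_mod_cast Nat.card_pos.ne'
  have hf1 := hf.map_one_ne_zero
  have hreal : starRingEnd ℂ (f 1) = f 1 := by rw [← hf.map_inv, inv_one]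
  have hinner : ∀ g x : G, ⟪ρ g b, ρ (g * x) b⟫_ℂ = ⟪b, ρ x b⟫_ℂ := fun g x => by
    rw [map_mul]
    exact LinearIsometryEquiv.inner_map_map _ _ _
  simp only [isotypicProjEnd, conjEnd_outerSelf]
  rw [frobInner_smul_sum_smul]
  simp only [frobInner_outerSelf, Complex.conj_conj]
  have hre : ∀ g, ∑ h, f g * starRingEnd ℂ (f h) * (‖⟪ρ g b, ρ h b⟫_ℂ‖ : ℂ) ^ 2 =
      ∑ x, f g * f (x⁻¹ * g⁻¹) * (‖⟪b, ρ x b⟫_ℂ‖ : ℂ) ^ 2 := fun g =>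
    (Fintype.sum_equiv (Equiv.mulLeft g) _ _ fun x => by
      rw [Equiv.coe_mulLeft, hinner, ← hf.map_inv, mul_inv_rev]).symm
  have hconv : ∀ x : G, ∑ g, f g * f (x⁻¹ * g⁻¹) = (Nat.card G : ℂ) / f 1 * f x⁻¹ := fun x => by
    rw [← hf.sum_inv_mul_mul]
    exact Fintype.sum_equiv (Equiv.inv G) _ _ fun g => by
      rw [Equiv.inv_apply, inv_inv, hf.map_mul_comm]
  simp only [hre]
  rw [Finset.sum_comm]
  simp only [← Finset.sum_mul, hconv, map_div₀, hreal, map_natCast]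
  simp only [mul_assoc, ← Finset.mul_sum]
  field_simp

end Frobenius

/-- For an irreducible unitary representation `ρ` of a finite group `G`,
a conjugacy class `M = [m₀]` of involutions, and `Π_m = (1/2)(id + ρ(m))`, the variance of
`‖Π_m b‖²` over uniform `m ∈ M` is at most
`(1/4) Σ_σ (χ_σ([m])/d_σ)·‖Π_σ(|b⟩⟨b|)‖²`, the sum over the irreducible characters of `G`,
with `Π_σ` the `σ`-isotypic projection of the conjugation representation on `End(V)`. -/
theorem variance_proj_sq_conjClass_involutions
    {G : Type} {V : Type*} [Group G] [Fintype G] [NormedAddCommGroup V]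
    [InnerProductSpace ℂ V] [FiniteDimensional ℂ V] (ρ : G →* (V ≃ₗᵢ[ℂ] V))
    (hirr : ∀ W : Submodule ℂ V, (∀ g : G, ∀ v ∈ W, ρ g v ∈ W) → W = ⊥ ∨ W = ⊤)
    (Irr : Finset (G → ℂ)) (hIrr : ∀ f, f ∈ Irr ↔ IsIrreducibleCharacter G f)
    (m₀ : G) (hm₀ : m₀ * m₀ = 1)
    (M : Finset G) (hM : ∀ m, m ∈ M ↔ IsConj m₀ m)
    (b : V) :
    (M.card : ℝ)⁻¹ * (∑ m ∈ M, (‖(2⁻¹ : ℂ) • (b + ρ m b)‖ ^ 2) ^ 2)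
        - ((M.card : ℝ)⁻¹ * ∑ m ∈ M, ‖(2⁻¹ : ℂ) • (b + ρ m b)‖ ^ 2) ^ 2
      ≤ (4⁻¹ : ℝ) * (∑ f ∈ Irr, (f m₀ / f 1) *
          frobInner (isotypicProjEnd ρ f (outerSelf b))
            (isotypicProjEnd ρ f (outerSelf b))).re := by
  classical
  have hcard : (Nat.card G : ℂ) ≠ 0 := by exact_mod_cast Nat.card_pos.ne'
  have hMpos : 0 < M.card := Finset.card_pos.2 ⟨m₀, (hM _).2 (IsConj.refl _)⟩
  have hMc : (M.card : ℝ) ≠ 0 := by exact_mod_cast hMpos.ne'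
  have hrhs : ∑ f ∈ Irr, (f m₀ / f 1) *
      frobInner (isotypicProjEnd ρ f (outerSelf b)) (isotypicProjEnd ρ f (outerSelf b)) =
      (((M.card : ℝ)⁻¹ * ∑ m ∈ M, ‖⟪b, ρ m b⟫_ℂ‖ ^ 2 : ℝ) : ℂ) := by
    have h1 : ∀ f ∈ Irr, (f m₀ / f 1) *
        frobInner (isotypicProjEnd ρ f (outerSelf b)) (isotypicProjEnd ρ f (outerSelf b)) =
        ∑ x, (Nat.card G : ℂ)⁻¹ * (f m₀ * f x⁻¹) * (‖⟪b, ρ x b⟫_ℂ‖ : ℂ) ^ 2 := by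
      intro f hf
      have hf' := (hIrr f).1 hf
      have hf1 := hf'.map_one_ne_zero
      rw [frobInner_isotypicProjEnd_outerSelf ρ hf', ← mul_assoc, Finset.mul_sum]
      refine Finset.sum_congr rfl fun x _ => ?_
      field_simp
    rw [Finset.sum_congr rfl h1, Finset.sum_comm]
    simp only [← Finset.sum_mul, ← Finset.mul_sum,
      sum_irreducibleCharacter_mul_inv Irr hIrr m₀ M hM]
    simp only [mul_ite, mul_zero, ite_mul, zero_mul, Finset.sum_ite_mem, Finset.univ_inter]
    push_cast
    rw [Finset.mul_sum]
    refine Finset.sum_congr rfl fun x _ => ?_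
    field_simp
  rw [hrhs, Complex.ofReal_re]
  have hX : ∀ m, ‖(2⁻¹ : ℂ) • (b + ρ m b)‖ ^ 2 =
      2⁻¹ * (‖b‖ ^ 2 + (⟪b, ρ m b⟫_ℂ).re) := by
    intro m
    rw [norm_smul, mul_pow, norm_add_sq (𝕜 := ℂ), LinearIsometryEquiv.norm_map]
    norm_num
    ring
  simp only [hX]
  have hle : ∑ m ∈ M, (⟪b, ρ m b⟫_ℂ).re ^ 2 ≤ ∑ m ∈ M, ‖⟪b, ρ m b⟫_ℂ‖ ^ 2 :=
    Finset.sum_le_sum fun m _ => by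
      rw [← sq_abs]
      exact pow_le_pow_left₀ (abs_nonneg _) (Complex.abs_re_le_norm _) 2
  have hsq : ∀ m, (2⁻¹ * (‖b‖ ^ 2 + (⟪b, ρ m b⟫_ℂ).re)) ^ 2 =
      4⁻¹ * ((‖b‖ ^ 2) ^ 2 + 2 * ‖b‖ ^ 2 * (⟪b, ρ m b⟫_ℂ).re + (⟪b, ρ m b⟫_ℂ).re ^ 2) :=
    fun m => by ring
  simp only [hsq]
  simp only [← Finset.mul_sum, Finset.sum_add_distrib, Finset.sum_const, nsmul_eq_mul]
  have hle' := mul_le_mul_of_nonneg_left hle (inv_nonneg.2 (Nat.cast_nonneg (α := ℝ) M.card))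
  set S := ∑ m ∈ M, (⟪b, ρ m b⟫_ℂ).re
  set Q := ∑ m ∈ M, (⟪b, ρ m b⟫_ℂ).re ^ 2
  have hvar : (M.card : ℝ)⁻¹ * (4⁻¹ * (M.card * (‖b‖ ^ 2) ^ 2 + 2 * ‖b‖ ^ 2 * S + Q)) -
      ((M.card : ℝ)⁻¹ * (2⁻¹ * (M.card * ‖b‖ ^ 2 + S))) ^ 2 =
      4⁻¹ * ((M.card : ℝ)⁻¹ * Q) - 4⁻¹ * ((M.card : ℝ)⁻¹ * S) ^ 2 := by
    field_simp
    ring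
  rw [hvar]
  nlinarith [sq_nonneg ((M.card : ℝ)⁻¹ * S)]
end

section
/- Let n be even and let M be the conjugacy class of the symmetric group S_n consisting of fixed-point-free involutions (products of n/2 disjoint transpositions). For each irreducible unitary representation λ of S_n on an inner product space V_λ of dimension d_λ, fix an orthonormal basis B_λ of V_λ; for m ∈ M let Π_m^λ = (1/2)(id + λ(m)) and let r_λ = rk Π_m^λ (which is independent of m ∈ M). Consider the joint distribution in which m is uniform on M and λ is observed with probability P(λ) = 2 d_λ r_λ / n!, and define the conditional distribution P_m on B_λ by P_m(b) = ‖Π_m^λ b‖²/r_λ. Then there is a constant δ > 0 such that for all sufficiently large even n, with probability at least 1 − e^{−δn} over the choice of m and λ, the total variation (L¹) distance ‖P_m − U‖₁ = Σ_{b∈B_λ} |P_m(b) − 1/d_λ| between P_m and the uniform distribution U on B_λ is less than e^{−δn}. -/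
open scoped Classical

/-- For an involution `m`, the operator `Π_m = (1/2)(id + ρ(m))`, the orthogonal
projection onto the `+1`-eigenspace of `ρ(m)`. -/
noncomputable def halfProj {G V : Type*} [Group G] [NormedAddCommGroup V]
    [InnerProductSpace ℂ V] (ρ : G →* (V ≃ₗᵢ[ℂ] V)) (m : G) : V →ₗ[ℂ] V :=
  (2⁻¹ : ℂ) • (LinearMap.id + ((ρ m).toLinearEquiv : V →ₗ[ℂ] V))

theorem inner_mul_inner_symm {V : Type*} [NormedAddCommGroup V] [InnerProductSpace ℂ V]
    (x y : V) : inner ℂ x y * inner ℂ y x = (‖inner ℂ y x‖ : ℂ) ^ 2 := by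
  rw [← inner_conj_symm]
  exact RCLike.conj_mul _

theorem sq_sum_norm_inner_sq_le {ι V : Type*} [NormedAddCommGroup V] [InnerProductSpace ℂ V]
    (s : Finset ι) (v : ι → V) {b : V} (hb : ‖b‖ = 1) :
    (∑ i ∈ s, ‖inner ℂ b (v i)‖ ^ 2) ^ 2 ≤ ∑ i ∈ s, ∑ j ∈ s, ‖inner ℂ (v i) (v j)‖ ^ 2 := by
  set S := ∑ i ∈ s, ‖inner ℂ b (v i)‖ ^ 2 with hS
  set Q := ∑ i ∈ s, ∑ j ∈ s, ‖inner ℂ (v i) (v j)‖ ^ 2 with hQ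
  set c : ι → ℂ := fun i => inner ℂ (v i) b with hc
  have hcn : ∀ i, ‖c i‖ = ‖inner ℂ b (v i)‖ := fun i => norm_inner_symm _ _
  have hS0 : 0 ≤ S := Finset.sum_nonneg fun i _ => by positivity
  have hQ0 : 0 ≤ Q := Finset.sum_nonneg fun i _ => Finset.sum_nonneg fun j _ => by positivity
  set u : V := ∑ i ∈ s, c i • v i with hu
  have hbu : inner ℂ b u = (S : ℂ) := by
    rw [hu, inner_sum, hS]
    push_cast
    refine Finset.sum_congr rfl fun i _ => ?_
    rw [inner_smul_right, hc]
    exact inner_mul_inner_symm _ _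
  have h1 : S ≤ ‖u‖ := by
    have := norm_inner_le_norm (𝕜 := ℂ) b u
    rw [hbu, hb, one_mul, Complex.norm_real, Real.norm_of_nonneg hS0] at this
    exact this
  have h2 : ‖u‖ ^ 2 ≤ ∑ p ∈ s ×ˢ s, (‖c p.1‖ * ‖c p.2‖) * ‖inner ℂ (v p.1) (v p.2)‖ := by
    have : ((‖u‖ ^ 2 : ℝ) : ℂ) = inner ℂ u u := by
      rw [inner_self_eq_norm_sq_to_K]; simp
    have h3 : ‖u‖ ^ 2 = ‖(inner ℂ u u : ℂ)‖ := by
      rw [← this, Complex.norm_real, Real.norm_of_nonneg (by positivity)]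
    rw [h3, hu, sum_inner, Finset.sum_product]
    refine (norm_sum_le _ _).trans (Finset.sum_le_sum fun i _ => ?_)
    rw [inner_sum]
    refine (norm_sum_le _ _).trans (Finset.sum_le_sum fun j _ => ?_)
    rw [inner_smul_left, inner_smul_right, norm_mul, norm_mul, RCLike.norm_conj]
    exact le_of_eq (by ring)
  have h4 := Finset.sum_mul_sq_le_sq_mul_sq (s ×ˢ s) (fun p => ‖c p.1‖ * ‖c p.2‖)
    (fun p => ‖inner ℂ (v p.1) (v p.2)‖)
  have h5 : ∑ p ∈ s ×ˢ s, (‖c p.1‖ * ‖c p.2‖) ^ 2 = S ^ 2 := by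
    rw [sq S, hS, Finset.sum_mul_sum, Finset.sum_product]
    simp only [hcn, mul_pow]
  rw [h5, Finset.sum_product (f := fun p : ι × ι => ‖inner ℂ (v p.1) (v p.2)‖ ^ 2)] at h4
  have h6 : (S ^ 2) ^ 2 ≤ S ^ 2 * Q :=
    (pow_le_pow_left₀ (sq_nonneg S)
      ((pow_le_pow_left₀ hS0 h1 2).trans h2) 2).trans h4
  rcases hS0.eq_or_lt with h | h
  · rw [← h]; simpa using hQ0
  · have : 0 < S ^ 2 := by positivity
    nlinarith

section
variable {G V : Type*} [Group G] [NormedAddCommGroup V] [InnerProductSpace ℂ V]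

theorem unitary_map_mul_apply (ρ : G →* (V ≃ₗᵢ[ℂ] V)) (g h : G) (x : V) :
    ρ (g * h) x = ρ g (ρ h x) := by
  rw [map_mul]; rfl

theorem norm_inner_map_map (ρ : G →* (V ≃ₗᵢ[ℂ] V)) (b : V) (g h : G) :
    ‖inner ℂ (ρ g b) (ρ h b)‖ = ‖inner ℂ b (ρ (g⁻¹ * h) b)‖ := by
  have : ρ h b = ρ g (ρ (g⁻¹ * h) b) := by
    rw [← unitary_map_mul_apply, mul_inv_cancel_left]
  rw [this, LinearIsometryEquiv.inner_map_map]

theorem sum_norm_inner_sq_pow_four_le (ρ : G →* (V ≃ₗᵢ[ℂ] V)) {b : V} (hb : ‖b‖ = 1)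
    (M : Finset G) (hM : ∀ m ∈ M, m⁻¹ = m) :
    (∑ m ∈ M, ‖inner ℂ b (ρ m b)‖ ^ 2) ^ 4 ≤
      ∑ p ∈ M ×ˢ M, ∑ q ∈ M ×ˢ M, ‖inner ℂ b (ρ ((p.1 * p.2)⁻¹ * (q.1 * q.2)) b)‖ ^ 2 := by
  have h1 := sq_sum_norm_inner_sq_le M (fun m => ρ m b) hb
  have h2 := sq_sum_norm_inner_sq_le (M ×ˢ M) (fun p => ρ (p.1 * p.2) b) hb
  simp only [norm_inner_map_map] at h1 h2
  have h3 : ∑ i ∈ M, ∑ j ∈ M, ‖inner ℂ b (ρ (i⁻¹ * j) b)‖ ^ 2 =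
      ∑ p ∈ M ×ˢ M, ‖inner ℂ b (ρ (p.1 * p.2) b)‖ ^ 2 := by
    rw [Finset.sum_product]
    exact Finset.sum_congr rfl fun i hi => by rw [hM i hi]
  rw [h3] at h1
  calc _ = ((∑ m ∈ M, ‖inner ℂ b (ρ m b)‖ ^ 2) ^ 2) ^ 2 := by ring
    _ ≤ _ := (pow_le_pow_left₀ (sq_nonneg _) h1 2).trans h2

end

section
variable {G V V' : Type*} [Group G] [Fintype G] [NormedAddCommGroup V] [InnerProductSpace ℂ V]
  [NormedAddCommGroup V'] [InnerProductSpace ℂ V']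

/-- The intertwiner obtained by averaging the rank-one map `x ↦ ⟪b, x⟫ c` over the group. -/
noncomputable def rankOneAverage (ρ : G →* (V ≃ₗᵢ[ℂ] V)) (ρ' : G →* (V' ≃ₗᵢ[ℂ] V'))
    (b : V) (c : V') : V →ₗ[ℂ] V' :=
  ∑ g, ((innerSL ℂ (ρ g b)) : V →ₗ[ℂ] ℂ).smulRight (ρ' g c)

theorem rankOneAverage_apply (ρ : G →* (V ≃ₗᵢ[ℂ] V)) (ρ' : G →* (V' ≃ₗᵢ[ℂ] V'))
    (b : V) (c : V') (x : V) :
    rankOneAverage ρ ρ' b c x = ∑ g, inner ℂ (ρ g b) x • ρ' g c := by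
  simp [rankOneAverage, LinearMap.sum_apply]

theorem rankOneAverage_map (ρ : G →* (V ≃ₗᵢ[ℂ] V)) (ρ' : G →* (V' ≃ₗᵢ[ℂ] V'))
    (b : V) (c : V') (h : G) (x : V) :
    rankOneAverage ρ ρ' b c (ρ h x) = ρ' h (rankOneAverage ρ ρ' b c x) := by
  rw [rankOneAverage_apply, rankOneAverage_apply, map_sum, ← Equiv.sum_comp (Equiv.mulLeft h)]
  refine Finset.sum_congr rfl fun g _ => ?_
  simp [LinearIsometryEquiv.inner_map_map]

theorem sum_norm_inner_sq_mul_finrank [FiniteDimensional ℂ V] (ρ : G →* (V ≃ₗᵢ[ℂ] V))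
    (hirr : ∀ W : Submodule ℂ V, (∀ g, ∀ v ∈ W, ρ g v ∈ W) → W = ⊥ ∨ W = ⊤)
    {b : V} (hb : ‖b‖ = 1) :
    (∑ g, ‖inner ℂ b (ρ g b)‖ ^ 2) * Module.finrank ℂ V = Fintype.card G := by
  have : Nontrivial V := ⟨b, 0, fun h => by simp [h] at hb⟩
  set f := rankOneAverage ρ ρ b b with hf
  obtain ⟨μ, hμ⟩ := Module.End.exists_eigenvalue f
  have hscal : ∀ x, f x = μ • x := by
    have hW : Module.End.eigenspace f μ = ⊤ := by
      refine (hirr _ fun g v hv => ?_).resolve_left hμ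
      rw [Module.End.mem_eigenspace_iff] at hv ⊢
      rw [hf, rankOneAverage_map, ← hf, hv, map_smul]
    intro x
    have : x ∈ Module.End.eigenspace f μ := by rw [hW]; trivial
    exact Module.End.mem_eigenspace_iff.1 this
  have h1 : ((∑ g, ‖inner ℂ b (ρ g b)‖ ^ 2 : ℝ) : ℂ) = μ := by
    have : inner ℂ b (f b) = μ := by
      rw [hscal, inner_smul_right, inner_self_eq_norm_sq_to_K, hb]; simp
    rw [← this, hf, rankOneAverage_apply, inner_sum]
    push_cast
    refine Finset.sum_congr rfl fun g _ => ?_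
    rw [inner_smul_right]
    exact (inner_mul_inner_symm _ _).symm
  have h2 : (Fintype.card G : ℂ) = Module.finrank ℂ V * μ := by
    let e := stdOrthonormalBasis ℂ V
    have h3 : ∑ k, inner ℂ (e k) (f (e k)) = Module.finrank ℂ V * μ := by
      simp [hscal]
    rw [← h3]
    simp only [hf, rankOneAverage_apply, inner_sum, inner_smul_right]
    rw [Finset.sum_comm]
    have h4 : ∀ g, ∑ k, inner ℂ (ρ g b) (e k) * inner ℂ (e k) (ρ g b) = 1 := by
      intro g
      rw [e.sum_inner_mul_inner, inner_self_eq_norm_sq_to_K, LinearIsometryEquiv.norm_map, hb]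
      simp
    simp [h4]
  have h5 : (((∑ g, ‖inner ℂ b (ρ g b)‖ ^ 2) * Module.finrank ℂ V : ℝ) : ℂ) =
      ((Fintype.card G : ℝ) : ℂ) := by
    rw [Complex.ofReal_mul, h1]; push_cast; rw [h2]; ring
  exact_mod_cast h5

end

section
variable {G : Type*} [Group G] [Fintype G]

/-- A family of pairwise disjoint unitary representations has at most as many
nonzero members as there are conjugacy classes. -/
theorem card_filter_finrank_pos_le {ι : Type*} [Fintype ι] (V : ι → Type*)
    [∀ i, NormedAddCommGroup (V i)] [∀ i, InnerProductSpace ℂ (V i)]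
    [∀ i, FiniteDimensional ℂ (V i)] (ρ : ∀ i, G →* (V i ≃ₗᵢ[ℂ] V i))
    (hdisj : ∀ i j, i ≠ j → ∀ f : V i →ₗ[ℂ] V j, (∀ g x, f (ρ i g x) = ρ j g (f x)) → f = 0) :
    Fintype.card {i // 0 < Module.finrank ℂ (V i)} ≤ Nat.card (ConjClasses G) := by
  let χ : ι → G → ℂ := fun i g => LinearMap.trace ℂ (V i) ((ρ i g).toLinearEquiv : V i →ₗ[ℂ] V i)
  have hχ : ∀ i (e : OrthonormalBasis (Fin (Module.finrank ℂ (V i))) ℂ (V i)) g,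
      χ i g = ∑ k, inner ℂ (e k) (ρ i g (e k)) := fun i e g =>
    LinearMap.trace_eq_sum_inner _ e
  have horth : ∀ i j, i ≠ j → ∑ g, star (χ i g) * χ j g = 0 := by
    intro i j hij
    let b := stdOrthonormalBasis ℂ (V i)
    let c := stdOrthonormalBasis ℂ (V j)
    simp only [hχ i b, hχ j c, star_sum, Finset.sum_mul_sum]
    rw [Finset.sum_comm]
    refine Finset.sum_eq_zero fun k _ => ?_
    rw [Finset.sum_comm]
    refine Finset.sum_eq_zero fun l _ => ?_
    have h0 := hdisj i j hij (rankOneAverage (ρ i) (ρ j) (b k) (c l))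
      (rankOneAverage_map (ρ i) (ρ j) (b k) (c l))
    have h1 : inner ℂ (c l) (rankOneAverage (ρ i) (ρ j) (b k) (c l) (b k)) = 0 := by
      rw [h0]; simp
    rw [rankOneAverage_apply, inner_sum] at h1
    rw [← h1]
    refine Finset.sum_congr rfl fun g _ => ?_
    rw [inner_smul_right]
    congr 1
    exact inner_conj_symm _ _
  have hone : ∀ i, χ i 1 = Module.finrank ℂ (V i) := by
    intro i
    rw [hχ i (stdOrthonormalBasis ℂ (V i))]
    simp
  have hconj : ∀ i g h, IsConj g h → χ i g = χ i h := by
    intro i g h hgh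
    obtain ⟨c, rfl⟩ := isConj_iff.1 hgh
    have h1 : ((ρ i (c * g * c⁻¹)).toLinearEquiv : V i →ₗ[ℂ] V i) =
        (((ρ i c).toLinearEquiv : V i →ₗ[ℂ] V i) * ((ρ i g).toLinearEquiv : V i →ₗ[ℂ] V i)) *
          ((ρ i c⁻¹).toLinearEquiv : V i →ₗ[ℂ] V i) := by
      ext x; simp
    have h2 : ((ρ i c⁻¹).toLinearEquiv : V i →ₗ[ℂ] V i) *
        (((ρ i c).toLinearEquiv : V i →ₗ[ℂ] V i) * ((ρ i g).toLinearEquiv : V i →ₗ[ℂ] V i)) =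
        ((ρ i g).toLinearEquiv : V i →ₗ[ℂ] V i) := by
      ext x
      change ρ i c⁻¹ (ρ i c (ρ i g x)) = ρ i g x
      rw [← unitary_map_mul_apply, inv_mul_cancel, map_one]; rfl
    change _ = LinearMap.trace ℂ (V i) _
    rw [h1, LinearMap.trace_mul_comm, h2]
  let ψ : {i // 0 < Module.finrank ℂ (V i)} → ConjClasses G → ℂ := fun i =>
    Quotient.lift (χ i) (hconj i)
  have hψ : LinearIndependent ℂ ψ := by
    rw [Fintype.linearIndependent_iff]
    intro a ha i
    have h1 : ∀ g, ∑ j, a j * χ j g = 0 := fun g => by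
      have := congrFun ha (ConjClasses.mk g)
      rw [Finset.sum_apply] at this
      exact this
    have h2 : ∑ g, star (χ i g) * ∑ j, a j * χ j g = 0 := by simp [h1]
    simp only [Finset.mul_sum] at h2
    rw [Finset.sum_comm, Finset.sum_eq_single i] at h2
    · have h3 : a i * ∑ g, star (χ i g) * χ i g = 0 := by
        rw [← h2, Finset.mul_sum]; exact Finset.sum_congr rfl fun g _ => by ring
      refine (mul_eq_zero.1 h3).resolve_right fun h4 => ?_
      have h5 : ((∑ g, ‖χ i g‖ ^ 2 : ℝ) : ℂ) = 0 := by
        rw [← h4]; push_cast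
        refine Finset.sum_congr rfl fun g _ => ?_
        exact (RCLike.conj_mul _).symm
      have h6 : ∑ g, ‖χ i g‖ ^ 2 = 0 := by exact_mod_cast h5
      have h7 := (Finset.sum_eq_zero_iff_of_nonneg fun g _ => by positivity).1 h6 1
        (Finset.mem_univ _)
      rw [hone] at h7
      have := i.2
      simp at h7
      omega
    · intro j _ hj
      have := horth i j (fun h => hj (Subtype.ext h.symm))
      calc _ = a j * ∑ g, star (χ i g) * χ j g := by
            rw [Finset.mul_sum]; exact Finset.sum_congr rfl fun g _ => by ring
        _ = 0 := by rw [this, mul_zero]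
    · simp
  rw [Nat.card_eq_fintype_card]
  simpa using hψ.fintype_card_le_finrank
end

/-- The fixed-point-free involutions of `Fin n`. -/
noncomputable def fpfInvolutions (n : ℕ) : Finset (Equiv.Perm (Fin n)) :=
  Finset.univ.filter (fun m : Equiv.Perm (Fin n) => m * m = 1 ∧ ∀ x, m x ≠ x)

theorem mem_fpfInvolutions {n : ℕ} {m : Equiv.Perm (Fin n)} :
    m ∈ fpfInvolutions n ↔ m * m = 1 ∧ ∀ x, m x ≠ x := by
  simp [fpfInvolutions]

theorem card_conjClasses_perm_le (n : ℕ) :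
    Nat.card (ConjClasses (Equiv.Perm (Fin n))) ≤ 2 ^ n := by
  rw [Nat.card_eq_fintype_card]
  let φ : ConjClasses (Equiv.Perm (Fin n)) → (Fintype.card (Fin n)).Partition :=
    Quotient.lift Equiv.Perm.partition fun _ _ h => Equiv.Perm.partition_eq_of_isConj.1 h
  have hφ : Function.Injective φ := by
    rintro ⟨a⟩ ⟨b⟩ h
    exact Quotient.sound (Equiv.Perm.partition_eq_of_isConj.2 h)
  calc _ ≤ Fintype.card (Fintype.card (Fin n)).Partition := Fintype.card_le_of_injective φ hφ
    _ ≤ Fintype.card (Composition (Fintype.card (Fin n))) :=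
      Fintype.card_le_of_surjective _ Nat.Partition.ofComposition_surj
    _ ≤ 2 ^ n := by
      rw [composition_card, Fintype.card_fin]
      exact Nat.pow_le_pow_right (by norm_num) (Nat.sub_le _ _)

theorem factorial_le_two_pow_mul_card_sq {n : ℕ} (hn : Even n) :
    n.factorial ≤ 2 ^ n * (fpfInvolutions n).card ^ 2 := by
  obtain ⟨h, rfl⟩ := hn
  have h1 : h.factorial ≤ (fpfInvolutions (h + h)).card := by
    let e : Fin h ⊕ Fin h ≃ Fin (h + h) := finSumFinEquiv
    let F : Equiv.Perm (Fin h) → Equiv.Perm (Fin (h + h)) := fun σ =>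
      (e.symm.trans ((Equiv.sumComm _ _).trans (Equiv.sumCongr σ.symm σ))).trans e
    have hF : ∀ σ, F σ ∈ fpfInvolutions (h + h) := by
      intro σ
      rw [mem_fpfInvolutions]
      constructor
      · ext x
        obtain ⟨y, rfl⟩ := e.surjective x
        rcases y with y | y <;> simp [F]
      · intro x
        obtain ⟨y, rfl⟩ := e.surjective x
        rcases y with y | y <;> simp [F]
    have hinj : Function.Injective F := by
      intro σ τ hστ
      ext a
      have := congrArg (fun f => f (e (Sum.inl a))) hστ
      simp [F] at this
      rw [this]
    have := Finset.card_le_card_of_injOn (s := Finset.univ) F (fun σ _ => hF σ) hinj.injOn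
    simpa [Fintype.card_perm] using this
  have h2 := Nat.add_choose_mul_factorial_mul_factorial h h
  have h3 := Nat.choose_le_two_pow (h + h) h
  calc (h + h).factorial = (h + h).choose h * (h.factorial ^ 2) := by rw [← h2]; ring
    _ ≤ _ := Nat.mul_le_mul h3 (Nat.pow_le_pow_left h1 2)

/-- Among all `g`, the number of pairs with `φ p⁻¹ * φ q = g` is maximal at `g = 1`. -/
theorem sum_sum_comp_le {G ι : Type*} [Group G] [Fintype G] [DecidableEq G] (P : Finset ι) (φ : ι → G)
    (w : G → ℝ) (hw : ∀ g, 0 ≤ w g) :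
    ∑ p ∈ P, ∑ q ∈ P, w ((φ p)⁻¹ * φ q) ≤
      (∑ h, ((P.filter (fun p => φ p = h)).card : ℝ) ^ 2) * ∑ g, w g := by
  let N : G → ℝ := fun h => ((P.filter (fun p => φ p = h)).card : ℝ)
  have key : ∀ f : G → ℝ, ∑ p ∈ P, f (φ p) = ∑ h, N h * f h := by
    intro f
    rw [← Finset.sum_fiberwise P φ]
    refine Finset.sum_congr rfl fun h _ => ?_
    rw [Finset.sum_congr rfl (g := fun _ => f h)
      (fun p hp => by rw [(Finset.mem_filter.1 hp).2])]
    simp [N]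
  have h1 : ∑ p ∈ P, ∑ q ∈ P, w ((φ p)⁻¹ * φ q) = ∑ h, ∑ g, N h * N (h * g) * w g := by
    rw [key fun a => ∑ q ∈ P, w (a⁻¹ * φ q)]
    refine Finset.sum_congr rfl fun h _ => ?_
    rw [key fun a => w (h⁻¹ * a), ← Equiv.sum_comp (Equiv.mulLeft h), Finset.mul_sum]
    refine Finset.sum_congr rfl fun g _ => ?_
    simp [mul_assoc]
  rw [h1, Finset.sum_comm, Finset.mul_sum]
  refine Finset.sum_le_sum fun g _ => ?_
  rw [← Finset.sum_mul]
  refine mul_le_mul_of_nonneg_right ?_ (hw g)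
  have h2 : ∑ h, N (h * g) ^ 2 = ∑ h, N h ^ 2 := Equiv.sum_comp (Equiv.mulRight g) fun h => N h ^ 2
  have h3 : ∑ h, N h * N (h * g) ≤ ∑ h, (N h ^ 2 + N (h * g) ^ 2) / 2 :=
    Finset.sum_le_sum fun h _ => by nlinarith [sq_nonneg (N h - N (h * g))]
  rw [← Finset.sum_div, Finset.sum_add_distrib, h2] at h3
  change _ ≤ ∑ h, N h ^ 2
  linarith

section
variable {n : ℕ}

/-- If `m` and `m * h` are fixed-point-free involutions, then so are all `m * h ^ k`; in
particular `m` moves every cycle of `h`. -/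
theorem not_sameCycle_of_mem {m h : Equiv.Perm (Fin n)} (hm : m ∈ fpfInvolutions n)
    (hmh : m * h ∈ fpfInvolutions n) (x : Fin n) : ¬ h.SameCycle x (m x) := by
  rw [mem_fpfInvolutions] at hm hmh
  have hmi : m⁻¹ = m := inv_eq_of_mul_eq_one_left hm.1
  have hinv : m * h * m⁻¹ = h⁻¹ := by
    rw [hmi]
    exact eq_inv_of_mul_eq_one_left (by rw [mul_assoc]; exact hmh.1)
  have hpow : ∀ k : ℤ, m * h ^ k * m⁻¹ = h ^ (-k) := fun k => by
    rw [← conj_zpow, hinv, inv_zpow, zpow_neg]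
  have hpow' : ∀ k : ℤ, m * h ^ k = h ^ (-k) * m := fun k => by
    rw [← hpow k]; group
  have hfp : ∀ k : ℤ, ∀ y, (m * h ^ k) y ≠ y := by
    intro k y hy
    obtain ⟨j, rfl | rfl⟩ := Int.even_or_odd' k
    · have : m * h ^ (2 * j) = h ^ (-j) * m * h ^ j := by
        rw [← hpow', mul_assoc, ← zpow_add, two_mul]
      rw [this] at hy
      apply hm.2 ((h ^ j) y)
      have := congrArg (h ^ j) hy
      rw [← Equiv.Perm.mul_apply, ← mul_assoc, ← mul_assoc, ← zpow_add] at this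
      simpa using this
    · have : m * h ^ (2 * j + 1) = h ^ (-j) * (m * h) * h ^ j := by
        rw [← mul_assoc, ← hpow', mul_assoc, mul_assoc, ← zpow_one_add, ← zpow_add]
        congr 2; ring
      rw [this] at hy
      apply hmh.2 ((h ^ j) y)
      have := congrArg (h ^ j) hy
      rw [← Equiv.Perm.mul_apply, ← mul_assoc, ← mul_assoc, ← zpow_add] at this
      simpa using this
  rintro ⟨k, hk⟩
  apply hfp k x
  rw [Equiv.Perm.mul_apply, hk, ← Equiv.Perm.mul_apply, hm.1]; rfl

/-- Fixed-point-free involutions inverting `h` and interchanging `S` with its complement. -/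
noncomputable def splitInverters (h : Equiv.Perm (Fin n)) (S : Finset (Fin n)) :
    Finset (Equiv.Perm (Fin n)) :=
  Finset.univ.filter fun m => m * m = 1 ∧ (∀ x, m (h x) = h⁻¹ (m x)) ∧
    (∀ x, h x ∈ S ↔ x ∈ S) ∧ ∀ x, m x ∈ S ↔ x ∉ S

theorem mem_splitInverters {h m : Equiv.Perm (Fin n)} {S : Finset (Fin n)} :
    m ∈ splitInverters h S ↔ m * m = 1 ∧ (∀ x, m (h x) = h⁻¹ (m x)) ∧
      (∀ x, h x ∈ S ↔ x ∈ S) ∧ ∀ x, m x ∈ S ↔ x ∉ S := by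
  simp [splitInverters]

theorem exists_mem_splitInverters {m h : Equiv.Perm (Fin n)} (hm : m ∈ fpfInvolutions n)
    (hmh : m * h ∈ fpfInvolutions n) : ∃ S, m ∈ splitInverters h S := by
  let f : Fin n → Fin n := fun x =>
    (Finset.univ.filter fun y => h.SameCycle x y).min' ⟨x, by simp [Equiv.Perm.SameCycle.refl]⟩
  have hf : ∀ x, h.SameCycle x (f x) := fun x =>
    (Finset.mem_filter.1 (Finset.min'_mem (Finset.univ.filter fun y => h.SameCycle x y) _)).2
  have hfe : ∀ x y, h.SameCycle x y → f x = f y := by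
    intro x y hxy
    have : (Finset.univ.filter fun z => h.SameCycle x z) =
        Finset.univ.filter fun z => h.SameCycle y z := by
      ext z
      simp only [Finset.mem_filter, Finset.mem_univ, true_and]
      exact ⟨fun hz => hxy.symm.trans hz, fun hz => hxy.trans hz⟩
    simp only [f, this]
  have hne : ∀ x, f x ≠ f (m x) := fun x hx =>
    not_sameCycle_of_mem hm hmh x ((hf x).trans (hx ▸ (hf (m x)).symm))
  rw [mem_fpfInvolutions] at hm hmh
  have hmm : ∀ x, m (m x) = x := fun x => by rw [← Equiv.Perm.mul_apply, hm.1]; rfl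
  have hinv : ∀ x, m (h x) = h⁻¹ (m x) := by
    intro x
    have : (m * h * (m * h)) x = x := by rw [hmh.1]; rfl
    simp only [Equiv.Perm.mul_apply] at this
    rw [Equiv.Perm.eq_inv_iff_eq, ← hmm (h (m (h x))), this]
  refine ⟨Finset.univ.filter fun x => f x < f (m x), mem_splitInverters.2 ⟨hm.1, hinv, ?_, ?_⟩⟩
  · intro x
    have h1 : f (h x) = f x := (hfe _ _ ⟨1, by simp⟩).symm
    have h2 : f (m (h x)) = f (m x) := (hfe _ _ ⟨-1, by simp [hinv]⟩).symm
    simp [h1, h2]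
  · intro x
    simp only [Finset.mem_filter, Finset.mem_univ, true_and, hmm, not_lt]
    exact ⟨fun h => h.le, fun h => lt_of_le_of_ne h (hne x).symm⟩

theorem card_splitInverters_sq_le (h : Equiv.Perm (Fin n)) (S : Finset (Fin n)) :
    (splitInverters h S).card ^ 2 ≤
      (Finset.univ.filter fun g : Equiv.Perm (Fin n) => g * h = h * g).card := by
  rcases (splitInverters h S).eq_empty_or_nonempty with h0 | ⟨m₀, hm₀⟩
  · simp [h0]
  rw [sq, ← Finset.card_product]
  have inv : ∀ {m}, m ∈ splitInverters h S → ∀ x, m (m x) = x := fun hm x => by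
    rw [← Equiv.Perm.mul_apply, (mem_splitInverters.1 hm).1]; rfl
  have inj : ∀ {m m'}, m ∈ splitInverters h S → m' ∈ splitInverters h S →
      (∀ x ∈ S, m x = m' x) → m = m' := by
    intro m m' hm hm' H
    ext1 x
    by_cases hx : x ∈ S
    · exact H x hx
    · have h1 : m x ∈ S := ((mem_splitInverters.1 hm).2.2.2 x).2 hx
      have h2 := H _ h1
      rw [inv hm] at h2
      rw [h2, inv hm', ← h2]
  obtain ⟨-, hc₀, hS, hs₀⟩ := mem_splitInverters.1 hm₀
  have hSi : ∀ x, h⁻¹ x ∈ S ↔ x ∈ S := fun x => by rw [← hS]; simp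
  have hhi : ∀ x, h (h⁻¹ x) = x := h.apply_symm_apply
  have hci : ∀ {m}, m ∈ splitInverters h S → ∀ x, m (h⁻¹ x) = h (m x) := by
    intro m hm x
    have := (mem_splitInverters.1 hm).2.1 (h⁻¹ x)
    rw [hhi] at this
    rw [this, hhi]
  let φ : Equiv.Perm (Fin n) × Equiv.Perm (Fin n) → Fin n → Fin n := fun p x =>
    if x ∈ S then m₀ (p.1 x) else p.2 (m₀ x)
  have hφ : ∀ p ∈ splitInverters h S ×ˢ splitInverters h S, Function.Injective (φ p) := by
    intro p hp x y hxy
    obtain ⟨hp1, hp2⟩ := Finset.mem_product.1 hp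
    have s1 := (mem_splitInverters.1 hp1).2.2.2
    have s2 := (mem_splitInverters.1 hp2).2.2.2
    have hmem : ∀ z, φ p z ∈ S ↔ z ∈ S := by
      intro z
      by_cases hz : z ∈ S
      · simp [φ, hz, hs₀, s1]
      · simp [φ, hz, hs₀, s2]
    have hxS : x ∈ S ↔ y ∈ S := by rw [← hmem x, hxy, hmem y]
    by_cases hx : x ∈ S
    · have hy := hxS.1 hx
      simpa [φ, hx, hy] using hxy
    · have hy : y ∉ S := fun h => hx (hxS.2 h)
      simpa only [φ, hx, hy, if_false, p.2.injective.eq_iff, m₀.injective.eq_iff] using hxy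
  let Φ : Equiv.Perm (Fin n) × Equiv.Perm (Fin n) → Equiv.Perm (Fin n) := fun p =>
    if hp : Function.Injective (φ p) then Equiv.ofBijective _ (Finite.injective_iff_bijective.1 hp)
    else 1
  have hΦ : ∀ p ∈ splitInverters h S ×ˢ splitInverters h S, ∀ x, Φ p x = φ p x := by
    intro p hp x
    simp [Φ, hφ p hp]
  refine Finset.card_le_card_of_injOn Φ ?_ ?_
  · intro p hp
    obtain ⟨hp1, hp2⟩ := Finset.mem_product.1 hp
    simp only [Finset.coe_filter, Finset.mem_univ, true_and, Set.mem_ofPred_eq]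
    ext1 x
    rw [Equiv.Perm.mul_apply, Equiv.Perm.mul_apply, hΦ p hp, hΦ p hp]
    by_cases hx : x ∈ S
    · simp only [φ, hS, hx, if_true]
      rw [(mem_splitInverters.1 hp1).2.1, hci hm₀]
    · simp only [φ, hS, hx, if_false]
      rw [hc₀, hci hp2]
  · intro p hp q hq hpq
    obtain ⟨hp1, hp2⟩ := Finset.mem_product.1 hp
    obtain ⟨hq1, hq2⟩ := Finset.mem_product.1 hq
    have H : ∀ x, φ p x = φ q x := fun x => by rw [← hΦ p hp, ← hΦ q hq, hpq]
    refine Prod.ext (inj hp1 hq1 fun x hx => ?_) (inj hp2 hq2 fun x hx => ?_)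
    · simpa [φ, hx] using H x
    · have hx' : m₀ x ∉ S := by rw [hs₀]; simpa using hx
      simpa [φ, hx', inv hm₀] using H (m₀ x)

theorem card_fiber_sq_le (h : Equiv.Perm (Fin n)) :
    ((fpfInvolutions n ×ˢ fpfInvolutions n).filter fun p => p.1 * p.2 = h).card ^ 2 ≤
      4 ^ n * (Finset.univ.filter fun g : Equiv.Perm (Fin n) => g * h = h * g).card := by
  have h1 : ((fpfInvolutions n ×ˢ fpfInvolutions n).filter fun p => p.1 * p.2 = h).card ≤
      ((Finset.univ : Finset (Finset (Fin n))).biUnion (splitInverters h)).card := by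
    refine Finset.card_le_card_of_injOn Prod.fst ?_ ?_
    · intro p hp
      obtain ⟨hpM, rfl⟩ := Finset.mem_filter.1 hp
      obtain ⟨hp1, hp2⟩ := Finset.mem_product.1 hpM
      have : p.1 * (p.1 * p.2) = p.2 := by
        rw [← mul_assoc, (mem_fpfInvolutions.1 hp1).1, one_mul]
      obtain ⟨S, hS⟩ := exists_mem_splitInverters (h := p.1 * p.2) hp1 (by rwa [this])
      exact Finset.mem_coe.2 (Finset.mem_biUnion.2 ⟨S, Finset.mem_univ _, hS⟩)
    · intro p hp q hq hpq
      have hp := (Finset.mem_filter.1 hp).2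
      have hq := (Finset.mem_filter.1 hq).2
      rw [← hq, hpq] at hp
      exact Prod.ext hpq (mul_left_cancel hp)
  have h2 := h1.trans Finset.card_biUnion_le
  calc _ ≤ (∑ S, (splitInverters h S).card) ^ 2 := Nat.pow_le_pow_left h2 2
    _ ≤ (Finset.univ : Finset (Finset (Fin n))).card * ∑ S, (splitInverters h S).card ^ 2 :=
      sq_sum_le_card_mul_sum_sq
    _ ≤ (Finset.univ : Finset (Finset (Fin n))).card *
        ∑ S : Finset (Fin n), (Finset.univ.filter fun g : Equiv.Perm (Fin n) => g * h = h * g).card :=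
      Nat.mul_le_mul_left _ (Finset.sum_le_sum fun S _ => card_splitInverters_sq_le h S)
    _ = _ := by
      simp only [Finset.sum_const, Finset.card_univ, Fintype.card_finset, Fintype.card_fin,
        smul_eq_mul]
      rw [← mul_assoc, ← mul_pow]; norm_num

theorem sum_card_fiber_sq_le (n : ℕ) :
    ∑ h, ((fpfInvolutions n ×ˢ fpfInvolutions n).filter fun p => p.1 * p.2 = h).card ^ 2 ≤
      8 ^ n * n.factorial := by
  have hcomm := card_comm_eq_card_conjClasses_mul_card (Equiv.Perm (Fin n))
  have h1 : ∑ h, (Finset.univ.filter fun g : Equiv.Perm (Fin n) => g * h = h * g).card =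
      Nat.card {p : Equiv.Perm (Fin n) × Equiv.Perm (Fin n) // Commute p.1 p.2} := by
    rw [Nat.card_eq_fintype_card, Fintype.card_subtype, Finset.card_eq_sum_ones, Finset.sum_filter,
      Fintype.sum_prod_type_right]
    refine Finset.sum_congr rfl fun h _ => ?_
    rw [← Finset.sum_filter, ← Finset.card_eq_sum_ones]
    congr 1
    ext g
    rw [Finset.mem_filter, Finset.mem_filter]
    exact Iff.rfl
  calc _ ≤ ∑ h, 4 ^ n * (Finset.univ.filter fun g : Equiv.Perm (Fin n) => g * h = h * g).card :=
        Finset.sum_le_sum fun h _ => card_fiber_sq_le h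
    _ = 4 ^ n * (Nat.card (ConjClasses (Equiv.Perm (Fin n))) * n.factorial) := by
      rw [← Finset.mul_sum, h1, hcomm, Nat.card_perm, Nat.card_fin]
    _ ≤ 4 ^ n * (2 ^ n * n.factorial) := by
      gcongr
      exact card_conjClasses_perm_le n
    _ = _ := by rw [← mul_assoc, ← mul_pow]; norm_num

end

section
variable {n : ℕ} {V : Type*} [NormedAddCommGroup V] [InnerProductSpace ℂ V]

theorem sum_abs_re_inner_le [FiniteDimensional ℂ V] (hn : Even n)
    (ρ : Equiv.Perm (Fin n) →* (V ≃ₗᵢ[ℂ] V))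
    (hirr : ∀ W : Submodule ℂ V, (∀ g, ∀ v ∈ W, ρ g v ∈ W) → W = ⊥ ∨ W = ⊤)
    (hd : ((2 : ℝ) ^ 37) ^ n ≤ Module.finrank ℂ V) {b : V} (hb : ‖b‖ = 1) :
    ∑ m ∈ fpfInvolutions n, |(inner ℂ b (ρ m b)).re| ≤
      (1 / 16 : ℝ) ^ n * (fpfInvolutions n).card := by
  set M := fpfInvolutions n with hM
  set d : ℝ := (Module.finrank ℂ V : ℝ) with hdd
  set c : ℝ := (M.card : ℝ) with hc
  set S : ℝ := ∑ m ∈ M, ‖inner ℂ b (ρ m b)‖ ^ 2 with hS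
  have hc0 : 0 ≤ c := Nat.cast_nonneg _
  have hS0 : 0 ≤ S := Finset.sum_nonneg fun _ _ => by positivity
  have hd0 : 0 < d := lt_of_lt_of_le (by positivity) hd
  have h1 : S ^ 4 ≤ (8 ^ n * n.factorial) * ∑ g, ‖inner ℂ b (ρ g b)‖ ^ 2 := by
    refine (sum_norm_inner_sq_pow_four_le ρ hb M fun m hm =>
      inv_eq_of_mul_eq_one_left (mem_fpfInvolutions.1 hm).1).trans ?_
    refine (sum_sum_comp_le (M ×ˢ M) (fun p => p.1 * p.2) (fun g => ‖inner ℂ b (ρ g b)‖ ^ 2)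
      fun g => by positivity).trans ?_
    refine mul_le_mul_of_nonneg_right ?_ (Finset.sum_nonneg fun _ _ => by positivity)
    have h := sum_card_fiber_sq_le n
    rw [← hM] at h
    exact_mod_cast h
  have h2 := sum_norm_inner_sq_mul_finrank ρ hirr hb
  rw [Fintype.card_perm, Fintype.card_fin] at h2
  have h3 : (n.factorial : ℝ) ≤ 2 ^ n * c ^ 2 := by
    have h := factorial_le_two_pow_mul_card_sq hn
    rw [← hM] at h
    rw [hc]
    exact_mod_cast h
  have h4 : S ^ 4 * d ≤ 8 ^ n * (2 ^ n * c ^ 2) ^ 2 := by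
    calc S ^ 4 * d ≤ (8 ^ n * n.factorial) * (∑ g, ‖inner ℂ b (ρ g b)‖ ^ 2) * d :=
          mul_le_mul_of_nonneg_right h1 hd0.le
      _ = 8 ^ n * (n.factorial : ℝ) ^ 2 := by rw [mul_assoc, h2]; ring
      _ ≤ _ := by gcongr
  have h5 : S ^ 4 ≤ ((1 / 256) ^ n * c) ^ 4 := by
    have h6 : S ^ 4 * (2 ^ 37) ^ n ≤ 8 ^ n * (2 ^ n * c ^ 2) ^ 2 :=
      (mul_le_mul_of_nonneg_left hd (by positivity)).trans h4
    have h7 : (8 : ℝ) ^ n * (2 ^ n * c ^ 2) ^ 2 = ((1 / 256) ^ n * c) ^ 4 * (2 ^ 37) ^ n := by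
      rw [mul_pow, mul_pow, ← pow_mul, ← pow_mul, ← pow_mul, mul_comm n 2, mul_comm n 4, pow_mul,
        pow_mul _ 4 n, ← mul_assoc, ← mul_pow, mul_right_comm, ← mul_pow]
      norm_num
    rw [h7] at h6
    exact le_of_mul_le_mul_right h6 (by positivity)
  have h8 : S ≤ (1 / 256) ^ n * c := le_of_pow_le_pow_left₀ (by norm_num) (by positivity) h5
  have h9 : (∑ m ∈ M, |(inner ℂ b (ρ m b)).re|) ^ 2 ≤ ((1 / 16 : ℝ) ^ n * c) ^ 2 := by
    calc _ ≤ c * ∑ m ∈ M, |(inner ℂ b (ρ m b)).re| ^ 2 := sq_sum_le_card_mul_sum_sq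
      _ ≤ c * S := by
        refine mul_le_mul_of_nonneg_left (Finset.sum_le_sum fun m _ => ?_) hc0
        exact pow_le_pow_left₀ (abs_nonneg _) (Complex.abs_re_le_norm _) 2
      _ ≤ c * ((1 / 256) ^ n * c) := mul_le_mul_of_nonneg_left h8 hc0
      _ = _ := by
        rw [mul_pow, ← pow_mul, mul_comm n 2, pow_mul]
        norm_num
        ring
  exact le_of_pow_le_pow_left₀ (by norm_num) (by positivity) h9

/-- The average over an orthonormal basis of `|Re ⟪b, ρ(m) b⟫|`. -/
noncomputable def meanDiag (ρ : Equiv.Perm (Fin n) →* (V ≃ₗᵢ[ℂ] V)) {d : ℕ}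
    (B : OrthonormalBasis (Fin d) ℂ V) (m : Equiv.Perm (Fin n)) : ℝ :=
  (∑ k, |(inner ℂ (B k) (ρ m (B k))).re|) / d

theorem card_filter_meanDiag_le [FiniteDimensional ℂ V] (hn : Even n)
    (ρ : Equiv.Perm (Fin n) →* (V ≃ₗᵢ[ℂ] V))
    (hirr : ∀ W : Submodule ℂ V, (∀ g, ∀ v ∈ W, ρ g v ∈ W) → W = ⊥ ∨ W = ⊤)
    (hd : ((2 : ℝ) ^ 37) ^ n ≤ Module.finrank ℂ V)
    (B : OrthonormalBasis (Fin (Module.finrank ℂ V)) ℂ V) :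
    (1 - (1 / 4 : ℝ) ^ n) * (fpfInvolutions n).card ≤
      ((fpfInvolutions n).filter fun m => meanDiag ρ B m ≤ (1 / 4 : ℝ) ^ n).card := by
  set M := fpfInvolutions n with hM
  have hd0 : (0 : ℝ) < Module.finrank ℂ V := lt_of_lt_of_le (by positivity) hd
  have h1 : ∑ m ∈ M, meanDiag ρ B m ≤ (1 / 16 : ℝ) ^ n * M.card := by
    simp only [meanDiag]
    rw [← Finset.sum_div, Finset.sum_comm, div_le_iff₀ hd0]
    refine (Finset.sum_le_sum fun k _ => sum_abs_re_inner_le hn ρ hirr hd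
      (B.orthonormal.1 k)).trans (le_of_eq ?_)
    simp
    ring
  have h2 : ((1 / 4 : ℝ) ^ n) * (M.filter fun m => ¬ meanDiag ρ B m ≤ (1 / 4 : ℝ) ^ n).card ≤
      ∑ m ∈ M, meanDiag ρ B m := by
    rw [mul_comm, ← nsmul_eq_mul]
    refine (Finset.card_nsmul_le_sum _ (meanDiag ρ B) _ fun m hm =>
      (not_le.1 (Finset.mem_filter.1 hm).2).le).trans ?_
    exact Finset.sum_le_sum_of_subset_of_nonneg (Finset.filter_subset _ _)
      fun m _ _ => div_nonneg (Finset.sum_nonneg fun _ _ => abs_nonneg _) (Nat.cast_nonneg _)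
  have h3 : ((1 / 16 : ℝ) ^ n) = (1 / 4) ^ n * (1 / 4) ^ n := by rw [← mul_pow]; norm_num
  have h4 : ((M.filter fun m => ¬ meanDiag ρ B m ≤ (1 / 4 : ℝ) ^ n).card : ℝ) ≤
      (1 / 4 : ℝ) ^ n * M.card := by
    have := h2.trans h1
    rw [h3, mul_assoc] at this
    exact le_of_mul_le_mul_left this (by positivity)
  have h5 : ((M.filter fun m => meanDiag ρ B m ≤ (1 / 4 : ℝ) ^ n).card : ℝ) +
      (M.filter fun m => ¬ meanDiag ρ B m ≤ (1 / 4 : ℝ) ^ n).card = M.card := by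
    exact_mod_cast Finset.card_filter_add_card_filter_not (s := M) _
  linarith

theorem norm_halfProj_sq (ρ : Equiv.Perm (Fin n) →* (V ≃ₗᵢ[ℂ] V)) (m : Equiv.Perm (Fin n))
    {b : V} (hb : ‖b‖ = 1) :
    ‖halfProj ρ m b‖ ^ 2 = (1 + (inner ℂ b (ρ m b)).re) / 2 := by
  have h1 : halfProj ρ m b = (2⁻¹ : ℂ) • (b + ρ m b) := rfl
  have h2 := norm_add_sq (𝕜 := ℂ) b (ρ m b)
  rw [LinearIsometryEquiv.norm_map, hb] at h2
  rw [h1, norm_smul, mul_pow, h2]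
  norm_num
  ring

theorem two_mul_finrank_range_halfProj [FiniteDimensional ℂ V]
    (ρ : Equiv.Perm (Fin n) →* (V ≃ₗᵢ[ℂ] V)) {m : Equiv.Perm (Fin n)} (hm : m * m = 1)
    {d : ℕ} (B : OrthonormalBasis (Fin d) ℂ V) :
    2 * (Module.finrank ℂ (LinearMap.range (halfProj ρ m)) : ℝ) =
      d + ∑ k, (inner ℂ (B k) (ρ m (B k))).re := by
  have hmm : ∀ x, ρ m (ρ m x) = x := fun x => by
    rw [← unitary_map_mul_apply, hm, map_one]; rfl
  have hap : ∀ x, halfProj ρ m x = (2⁻¹ : ℂ) • (x + ρ m x) := fun x => rfl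
  have hidem : IsIdempotentElem (halfProj ρ m) := by
    ext x
    change halfProj ρ m (halfProj ρ m x) = halfProj ρ m x
    simp only [hap, map_smul, map_add, hmm]
    rw [add_comm (ρ m x) x, ← smul_add, ← two_smul ℂ (x + ρ m x), smul_smul (2⁻¹ : ℂ) 2]
    norm_num
  have h1 := (LinearMap.IsIdempotentElem.isProj_range _ hidem).trace
  rw [LinearMap.trace_eq_sum_inner _ B] at h1
  have h2 := congrArg Complex.re h1
  rw [Complex.natCast_re] at h2
  rw [← h2, Complex.re_sum, Finset.mul_sum]
  have h3 : ∀ k, 2 * (inner ℂ (B k) (halfProj ρ m (B k))).re =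
      1 + (inner ℂ (B k) (ρ m (B k))).re := by
    intro k
    rw [hap, inner_smul_right, inner_add_right, inner_self_eq_norm_sq_to_K, B.orthonormal.1 k]
    simp
  simp only [h3, Finset.sum_add_distrib]
  simp

theorem halfProj_near_uniform [FiniteDimensional ℂ V]
    (ρ : Equiv.Perm (Fin n) →* (V ≃ₗᵢ[ℂ] V)) {m : Equiv.Perm (Fin n)} (hm : m * m = 1)
    {d : ℕ} (hd : 0 < d) (B : OrthonormalBasis (Fin d) ℂ V) {η : ℝ}
    (hη : meanDiag ρ B m ≤ η) (hη2 : η ≤ 1 / 2) :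
    (d : ℝ) * (1 - η) ≤ 2 * (Module.finrank ℂ (LinearMap.range (halfProj ρ m)) : ℝ) ∧
    ∑ k, |‖halfProj ρ m (B k)‖ ^ 2 /
      (Module.finrank ℂ (LinearMap.range (halfProj ρ m)) : ℝ) - 1 / (d : ℝ)| ≤ 4 * η := by
  set r : ℝ := (Module.finrank ℂ (LinearMap.range (halfProj ρ m)) : ℝ) with hr
  set f : Fin d → ℝ := fun k => (inner ℂ (B k) (ρ m (B k))).re with hf
  have hd0 : (0 : ℝ) < d := Nat.cast_pos.2 hd
  have hr2 : 2 * r = d + ∑ k, f k := two_mul_finrank_range_halfProj ρ hm B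
  have hA : ∑ k, |f k| ≤ η * d := (div_le_iff₀ hd0).1 hη
  have hF : |∑ k, f k| ≤ η * d := (Finset.abs_sum_le_sum_abs _ _).trans hA
  have h1 : (d : ℝ) * (1 - η) ≤ 2 * r := by
    have := (abs_le.1 hF).1
    linarith
  have hr0 : 0 < r := by nlinarith
  have hdr : (d : ℝ) ≤ 4 * r := by nlinarith
  refine ⟨h1, ?_⟩
  have h2 : ∀ k, |‖halfProj ρ m (B k)‖ ^ 2 / r - 1 / (d : ℝ)| =
      |d * f k - ∑ j, f j| / (2 * r * d) := by
    intro k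
    have h3 : ‖halfProj ρ m (B k)‖ ^ 2 / r - 1 / (d : ℝ) =
        (d * f k - ∑ j, f j) / (2 * r * d) := by
      rw [norm_halfProj_sq ρ m (B.orthonormal.1 k), div_sub_div _ _ hr0.ne' hd0.ne',
        div_eq_div_iff (by positivity) (by positivity)]
      have : ∑ j, f j = 2 * r - d := by linarith
      rw [this]
      simp only [f]
      ring
    rw [h3, abs_div, abs_of_pos (show (0 : ℝ) < 2 * r * d by positivity)]
  simp only [h2]
  rw [← Finset.sum_div, div_le_iff₀ (by positivity)]
  calc ∑ k, |d * f k - ∑ j, f j| ≤ ∑ k, (d * |f k| + η * d) := by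
        refine Finset.sum_le_sum fun k _ => (abs_sub _ _).trans ?_
        rw [abs_mul, abs_of_pos hd0]
        linarith
    _ = d * ∑ k, |f k| + d * (η * d) := by
        rw [Finset.sum_add_distrib, ← Finset.mul_sum]; simp
    _ ≤ 2 * η * d * d := by nlinarith
    _ ≤ 4 * η * (2 * r * d) := by
        have hη0 : 0 ≤ η := by
          have := (Finset.sum_nonneg fun k (_ : k ∈ Finset.univ) => abs_nonneg (f k)).trans hA
          nlinarith
        nlinarith [mul_nonneg hη0 hd0.le]

end

theorem eventually_pow_mul_le_factorial :
    ∀ᶠ n : ℕ in Filter.atTop, (((2 : ℝ) ^ 37) ^ n) ^ 2 * 2 ^ n ≤ (1 / 4) ^ n * n.factorial := by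
  have h := FloorSemiring.tendsto_pow_div_factorial_atTop ((2 : ℝ) ^ 77)
  filter_upwards [h.eventually_le_const one_pos] with n hn
  have h0 : (0 : ℝ) < n.factorial := Nat.cast_pos.2 n.factorial_pos
  rw [div_le_one h0] at hn
  calc (((2 : ℝ) ^ 37) ^ n) ^ 2 * 2 ^ n = (1 / 4) ^ n * (2 ^ 77) ^ n := by
        rw [← pow_mul, mul_comm n 2, pow_mul, ← mul_pow, ← mul_pow]; norm_num
    _ ≤ _ := by gcongr

theorem sub_le_sum_sq_of_card_le {ι : Type*} [Fintype ι] (d : ι → ℕ) {D K F : ℝ}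
    (hsum : ∑ i, (d i : ℝ) ^ 2 = F)
    (hK : ((Finset.univ.filter fun i => 0 < d i).card : ℝ) ≤ K) :
    F - D ^ 2 * K ≤ ∑ i ∈ Finset.univ.filter (fun i => D ≤ d i), (d i : ℝ) ^ 2 := by
  have h1 : ∑ i ∈ Finset.univ.filter (fun i => D ≤ d i), (d i : ℝ) ^ 2 +
      ∑ i ∈ Finset.univ.filter (fun i => ¬ D ≤ d i), (d i : ℝ) ^ 2 = F := by
    rw [Finset.sum_filter_add_sum_filter_not, hsum]
  have h2 : ∑ i ∈ Finset.univ.filter (fun i => ¬ D ≤ d i), (d i : ℝ) ^ 2 ≤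
      ∑ i ∈ Finset.univ.filter (fun i => 0 < d i), D ^ 2 := by
    rw [Finset.sum_filter, Finset.sum_filter]
    refine Finset.sum_le_sum fun i _ => ?_
    split_ifs with h3 h4 h4
    · positivity
    · exact le_rfl
    · exact pow_le_pow_left₀ (Nat.cast_nonneg _) (not_le.1 h3).le 2
    · simp [Nat.eq_zero_of_not_pos h4]
  rw [Finset.sum_const, nsmul_eq_mul] at h2
  have h5 := mul_le_mul_of_nonneg_right hK (sq_nonneg D)
  linarith

/-- **Theorem 1 of the paper.**  Let `n` be even and `M ⊂ S_n` the
conjugacy class of fixed-point-free involutions.  For each member of a complete family of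
pairwise non-isomorphic irreducible unitary representations `λ` of `S_n`, fix an
orthonormal basis `B_λ`.  Under the joint distribution where `m` is uniform on `M` and
`λ` is observed with probability `P(λ) = 2 d_λ r_λ(m) / n!` (with
`r_λ(m) = rk Π_m^λ`), with probability at least `1 − e^{−δn}` the conditional
distribution `P_m(b) = ‖Π_m^λ b‖²/r_λ` on `B_λ` is within total variation distance
`e^{−δn}` of the uniform distribution on `B_λ`, for some constant `δ > 0` and all
sufficiently large even `n`. -/
theorem strong_fourier_sampling_close_to_uniform :
    ∃ δ > (0 : ℝ), ∃ N : ℕ, ∀ n ≥ N, Even n →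
      ∀ (ι : Type) [Fintype ι] (V : ι → Type)
        [∀ i, NormedAddCommGroup (V i)] [∀ i, InnerProductSpace ℂ (V i)]
        [∀ i, FiniteDimensional ℂ (V i)]
        (ρ : ∀ i, Equiv.Perm (Fin n) →* (V i ≃ₗᵢ[ℂ] V i)),
        (∀ i, ∀ W : Submodule ℂ (V i),
          (∀ g : Equiv.Perm (Fin n), ∀ v ∈ W, ρ i g v ∈ W) → W = ⊥ ∨ W = ⊤) →
        (∀ i j, i ≠ j → ∀ f : V i →ₗ[ℂ] V j,
          (∀ g x, f (ρ i g x) = ρ j g (f x)) → f = 0) →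
        (∑ i, (Module.finrank ℂ (V i)) ^ 2 = n.factorial) →
        ∀ B : ∀ i, OrthonormalBasis (Fin (Module.finrank ℂ (V i))) ℂ (V i),
        1 - Real.exp (-δ * n) ≤
          (((Finset.univ.filter (fun m : Equiv.Perm (Fin n) =>
              m * m = 1 ∧ ∀ x, m x ≠ x)).card : ℝ))⁻¹ *
          ∑ m ∈ Finset.univ.filter (fun m : Equiv.Perm (Fin n) =>
              m * m = 1 ∧ ∀ x, m x ≠ x),
            ∑ i ∈ Finset.univ.filter (fun i =>
                (∑ k : Fin (Module.finrank ℂ (V i)),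
                  |‖halfProj (ρ i) m (B i k)‖ ^ 2 /
                      (Module.finrank ℂ (LinearMap.range (halfProj (ρ i) m)) : ℝ) -
                    1 / (Module.finrank ℂ (V i) : ℝ)|)
                  < Real.exp (-δ * n)),
              2 * (Module.finrank ℂ (V i) : ℝ) *
                (Module.finrank ℂ (LinearMap.range (halfProj (ρ i) m)) : ℝ) /
                (n.factorial : ℝ) := by
  obtain ⟨N, hN⟩ := Filter.eventually_atTop.1 eventually_pow_mul_le_factorial
  refine ⟨Real.log 2, Real.log_pos (by norm_num), max N 3, ?_⟩
  intro n hnN hn ι _ V _ _ _ ρ hirr hdisj hsum B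
  have hn3 : 3 ≤ n := le_of_max_le_right hnN
  have hfac := hN n (le_of_max_le_left hnN)
  have hexp : Real.exp (-Real.log 2 * n) = (1 / 2 : ℝ) ^ n := by
    rw [mul_comm, Real.exp_nat_mul, Real.exp_neg, Real.exp_log (by norm_num)]; norm_num
  rw [hexp]
  set η : ℝ := (1 / 4 : ℝ) ^ n with hη
  have hη0 : 0 < η := by positivity
  have hhalf : (1 / 2 : ℝ) ^ n ≤ 1 / 8 :=
    (pow_le_pow_of_le_one (by norm_num) (by norm_num) hn3).trans (by norm_num)
  have hhalf0 : (0 : ℝ) < (1 / 2) ^ n := by positivity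
  have hηh : η = (1 / 2) ^ n * (1 / 2) ^ n := by rw [hη, ← mul_pow]; norm_num
  have h4η : 4 * η < (1 / 2) ^ n := by nlinarith
  have hη2 : η ≤ 1 / 2 := by nlinarith
  have hF0 : (0 : ℝ) < n.factorial := Nat.cast_pos.2 n.factorial_pos
  let d : ι → ℕ := fun i => Module.finrank ℂ (V i)
  let big : Finset ι := Finset.univ.filter fun i => ((2 : ℝ) ^ 37) ^ n ≤ d i
  have hbig : (1 - η) * n.factorial ≤ ∑ i ∈ big, (d i : ℝ) ^ 2 := by
    have h3 : ((Finset.univ.filter (fun i => 0 < d i)).card : ℝ) ≤ ((2 ^ n : ℕ) : ℝ) := by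
      have h4 := (card_filter_finrank_pos_le V ρ hdisj).trans (card_conjClasses_perm_le n)
      rw [Fintype.card_subtype] at h4
      exact Nat.cast_le.2 h4
    rw [Nat.cast_pow, Nat.cast_ofNat] at h3
    have hsum' : ∑ i, (d i : ℝ) ^ 2 = n.factorial := by
      rw [← hsum, Nat.cast_sum]
      exact Finset.sum_congr rfl fun i _ => (Nat.cast_pow _ _).symm
    have h5 := sub_le_sum_sq_of_card_le d (D := ((2 : ℝ) ^ 37) ^ n) hsum' h3
    refine le_trans ?_ h5
    linarith
  change 1 - (1 / 2 : ℝ) ^ n ≤ ((fpfInvolutions n).card : ℝ)⁻¹ * ∑ m ∈ fpfInvolutions n, _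
  set c : ℝ := ((fpfInvolutions n).card : ℝ) with hc
  have hc0 : 0 < c := by
    have h1 := (n.factorial_pos).trans_le (factorial_le_two_pow_mul_card_sq hn)
    have h2 : 0 < (fpfInvolutions n).card := by
      by_contra h
      simp [Nat.eq_zero_of_not_pos h] at h1
    exact Nat.cast_pos.2 h2
  rw [inv_mul_eq_div, le_div_iff₀ hc0]
  have hlow : ∑ m ∈ fpfInvolutions n, ∑ i ∈ big,
      (if meanDiag (ρ i) (B i) m ≤ η then (1 - η) * (d i : ℝ) ^ 2 / n.factorial else 0) ≤
      ∑ m ∈ fpfInvolutions n,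
            ∑ i ∈ Finset.univ.filter (fun i =>
                (∑ k : Fin (Module.finrank ℂ (V i)),
                  |‖halfProj (ρ i) m (B i k)‖ ^ 2 /
                      (Module.finrank ℂ (LinearMap.range (halfProj (ρ i) m)) : ℝ) -
                    1 / (Module.finrank ℂ (V i) : ℝ)|)
                  < (1 / 2 : ℝ) ^ n),
              2 * (Module.finrank ℂ (V i) : ℝ) *
                (Module.finrank ℂ (LinearMap.range (halfProj (ρ i) m)) : ℝ) /
                (n.factorial : ℝ) := by
    refine Finset.sum_le_sum fun m hm => ?_
    rw [← Finset.sum_filter]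
    have key : ∀ i ∈ big.filter (fun i => meanDiag (ρ i) (B i) m ≤ η), _ := fun i hi =>
      halfProj_near_uniform (ρ i) (mem_fpfInvolutions.1 hm).1
        (Nat.cast_pos.1 (lt_of_lt_of_le (by positivity)
          (Finset.mem_filter.1 (Finset.mem_filter.1 hi).1).2) : 0 < d i)
        (B i) (Finset.mem_filter.1 hi).2 hη2
    refine (Finset.sum_le_sum fun i hi => ?_).trans
      (Finset.sum_le_sum_of_subset_of_nonneg
        (s := big.filter (fun i => meanDiag (ρ i) (B i) m ≤ η)) ?_ fun i _ _ => by positivity)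
    · have h1 := (key i hi).1
      refine div_le_div_of_nonneg_right ?_ hF0.le
      have h2 := mul_le_mul_of_nonneg_left h1 (Nat.cast_nonneg (α := ℝ) (d i))
      simp only [d] at h2 ⊢
      linarith
    · intro i hi
      exact Finset.mem_filter.2 ⟨Finset.mem_univ _, (key i hi).2.trans_lt h4η⟩
  refine le_trans ?_ hlow
  rw [Finset.sum_comm]
  have hcol : ∀ i ∈ big, (1 - η) * c * ((1 - η) * (d i : ℝ) ^ 2 / n.factorial) ≤
      ∑ m ∈ fpfInvolutions n,
        (if meanDiag (ρ i) (B i) m ≤ η then (1 - η) * (d i : ℝ) ^ 2 / n.factorial else 0) := by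
    intro i hi
    rw [← Finset.sum_filter, Finset.sum_const, nsmul_eq_mul]
    refine mul_le_mul_of_nonneg_right
      (card_filter_meanDiag_le hn (ρ i) (hirr i) (Finset.mem_filter.1 hi).2 (B i)) ?_
    have : 0 ≤ 1 - η := by linarith
    positivity
  refine le_trans ?_ (Finset.sum_le_sum hcol)
  rw [← Finset.mul_sum, ← Finset.sum_div, ← Finset.mul_sum]
  have h1 : (1 - η) * (1 - η) ≤ (1 - η) * (∑ i ∈ big, (d i : ℝ) ^ 2) / n.factorial := by
    rw [le_div_iff₀ hF0, mul_assoc]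
    exact mul_le_mul_of_nonneg_left hbig (by linarith)
  have h2 : 1 - (1 / 2 : ℝ) ^ n ≤ (1 - η) * ((1 - η) * (1 - η)) := by
    nlinarith [mul_pos hη0 hη0]
  calc (1 - (1 / 2 : ℝ) ^ n) * c ≤ (1 - η) * ((1 - η) * (1 - η)) * c :=
        mul_le_mul_of_nonneg_right h2 hc0.le
    _ = (1 - η) * c * ((1 - η) * (1 - η)) := by ring
    _ ≤ _ := mul_le_mul_of_nonneg_left h1 (mul_nonneg (by linarith) hc0.le)
end
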